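/- Let 0 < λ ≤ 1 and let f ∈ 𝒢(λ). Then the analytic function z ↦ f(z)/z (extended by value 1 at z = 0) is subordinate on 𝔻 to the analytic function h(z) = ((1+z)^{1+λ} − 1)/((1+λ) z) (extended by value 1 at z = 0). -/

import Mathlib

open Complex Metric

/-- `p ≺ q` on the unit disk: there is an analytic `ω : 𝔻 → 𝔻` with `ω 0 = 0`
and `p = q ∘ ω` on `𝔻`. -/
def Subord (p q : ℂ → ℂ) : Prop :=
  ∃ ω : ℂ → ℂ, DifferentiableOn ℂ ω (ball 0 1) ∧
    Set.MapsTo ω (ball 0 1) (ball 0 1) ∧ ω 0 = 0 ∧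
    ∀ z ∈ ball (0:ℂ) 1, p z = q (ω z)

/-- `h(z) = ((1+z)^{1+λ} − 1)/((1+λ) z)`, extended by the value `1` at `z = 0`. -/
noncomputable def hFun (lam : ℝ) : ℂ → ℂ := fun z =>
  if z = 0 then 1
  else (Complex.exp (((1 + lam : ℝ) : ℂ) * Complex.log (1 + z)) - 1) /
    (((1 + lam : ℝ) : ℂ) * z)

open Set

/-- If the derivative of a path has positive real part, its real part increases. -/
lemma re_lt_re_of_hasDerivAt {φ φ' : ℝ → ℂ}
    (hφ : ∀ t ∈ Icc (0 : ℝ) 1, HasDerivAt φ (φ' t) t)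
    (hpos : ∀ t ∈ Ioo (0 : ℝ) 1, 0 < (φ' t).re) : (φ 0).re < (φ 1).re := by
  have hre : ∀ t ∈ Icc (0 : ℝ) 1, HasDerivAt (fun t => (φ t).re) (φ' t).re t := fun t ht =>
    Complex.reCLM.hasFDerivAt.comp_hasDerivAt t (hφ t ht)
  have hmono : StrictMonoOn (fun t => (φ t).re) (Icc 0 1) := by
    refine strictMonoOn_of_deriv_pos (convex_Icc 0 1)
      (fun t ht => (hre t ht).continuousAt.continuousWithinAt) fun t ht => ?_
    rw [interior_Icc] at ht
    rw [(hre t (Ioo_subset_Icc_self ht)).deriv]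
    exact hpos t ht
  exact hmono (left_mem_Icc.2 zero_le_one) (right_mem_Icc.2 zero_le_one) zero_lt_one

/-- **Jack's lemma**. -/
lemma exists_mul_deriv_eq_of_isMax {R : ℝ} {ω : ℂ → ℂ} (hω : DifferentiableOn ℂ ω (ball 0 R))
    (hω0 : ω 0 = 0) {z₀ : ℂ} (hz₀ : z₀ ∈ ball (0 : ℂ) R) (hne : ω z₀ ≠ 0)
    (hmax : ∀ z, ‖z‖ ≤ ‖z₀‖ → ‖ω z‖ ≤ ‖ω z₀‖) :
    ∃ k : ℝ, 1 ≤ k ∧ z₀ * deriv ω z₀ = k * ω z₀ := by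
  have hz₀ne : z₀ ≠ 0 := by
    rintro rfl
    exact hne hω0
  have hz₀R : ‖z₀‖ < R := by simpa using hz₀
  have hschwarz : ∀ z, ‖z‖ ≤ ‖z₀‖ → ‖ω z‖ ≤ ‖ω z₀‖ / ‖z₀‖ * ‖z‖ := by
    intro z hz
    rcases hz.lt_or_eq with hz | hz
    · have := dist_le_div_mul_dist_of_mapsTo_ball (f := ω) (c := 0) (R₁ := ‖z₀‖) (R₂ := ‖ω z₀‖)
        (z := z) (hω.mono (ball_subset_ball hz₀R.le))
        (fun u hu => by simpa [hω0] using hmax u (mem_ball_zero_iff.1 hu).le) (by simpa using hz)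
      simpa [hω0] using this
    · rw [hz, div_mul_cancel₀ _ (norm_ne_zero_iff.2 hz₀ne)]
      exact hmax z hz.le
  set c : ℂ := z₀ * deriv ω z₀ / ω z₀ with hc
  have hd : HasDerivAt (fun s : ℂ => ω (z₀ * exp s) * exp (-s) / ω z₀) (c - 1) 0 := by
    have h1 : HasDerivAt (fun s : ℂ => z₀ * exp s) z₀ 0 := by
      simpa using (Complex.hasDerivAt_exp 0).const_mul z₀
    have h2 : HasDerivAt ω (deriv ω z₀) (z₀ * exp 0) := by
      simpa using (hω.differentiableAt (isOpen_ball.mem_nhds hz₀)).hasDerivAt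
    have h3 : HasDerivAt (fun s : ℂ => exp (-s)) (-1) 0 := by
      simpa using (hasDerivAt_neg (0 : ℂ)).cexp
    have h4 := ((h2.comp 0 h1).mul h3).div_const (ω z₀)
    refine h4.congr_deriv ?_
    simp only [Function.comp_apply, exp_zero, neg_zero, mul_one, hc]
    field_simp
    ring
  have hd' : HasFDerivAt (fun s : ℂ => (ω (z₀ * exp s) * exp (-s) / ω z₀).re)
      (Complex.reCLM.comp (((ContinuousLinearMap.toSpanSingleton ℂ (c - 1)) :
        ℂ →L[ℂ] ℂ).restrictScalars ℝ)) 0 :=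
    Complex.reCLM.hasFDerivAt.comp (0 : ℂ) (hd.hasFDerivAt.restrictScalars ℝ)
  have hle : ∀ s : ℂ, s.re ≤ 0 → (ω (z₀ * exp s) * exp (-s) / ω z₀).re ≤ 1 := by
    intro s hs
    refine (Complex.re_le_norm _).trans ?_
    have h1 : ‖z₀ * exp s‖ ≤ ‖z₀‖ := by
      rw [norm_mul, Complex.norm_exp]
      exact mul_le_of_le_one_right (norm_nonneg _) (Real.exp_le_one_iff.2 hs)
    have h2 := hschwarz _ h1
    have hωpos : 0 < ‖ω z₀‖ := norm_pos_iff.2 hne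
    have hzpos : 0 < ‖z₀‖ := norm_pos_iff.2 hz₀ne
    rw [norm_div, norm_mul, div_le_one hωpos]
    calc ‖ω (z₀ * exp s)‖ * ‖exp (-s)‖
        ≤ (‖ω z₀‖ / ‖z₀‖ * ‖z₀ * exp s‖) * ‖exp (-s)‖ := by gcongr
      _ = ‖ω z₀‖ := by
        rw [norm_mul, Complex.norm_exp, Complex.norm_exp, neg_re, Real.exp_neg]
        field_simp
  have hloc : IsLocalMaxOn (fun s : ℂ => (ω (z₀ * exp s) * exp (-s) / ω z₀).re)
      {s : ℂ | s.re ≤ 0} 0 := by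
    filter_upwards [self_mem_nhdsWithin] with s hs
    simpa [div_self hne] using hle s hs
  have hdir : ∀ d : ℂ, d.re ≤ 0 → (d * (c - 1)).re ≤ 0 := by
    intro d hd0
    have := hloc.hasFDerivWithinAt_nonpos hd'.hasFDerivWithinAt (y := d) <| by
      refine mem_posTangentConeAt_of_segment_subset fun x hx => ?_
      exact (convex_halfSpace_re_le 0).segment_subset (by simp) (by simpa using hd0) hx
    simpa using this
  have h1 := hdir (-1) (by simp)
  have h2 := hdir I (by simp)
  have h3 := hdir (-I) (by simp)
  simp at h1 h2 h3
  refine ⟨c.re, by linarith, ?_⟩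
  have him : c.im = 0 := by linarith
  have : (c.re : ℂ) = c := Complex.ext (by simp) (by simp [him])
  rw [this, hc, div_mul_cancel₀ _ hne]

/-- Positivity of the real part is preserved by interpolating the argument. -/
lemma re_mul_exp_pos_of_interpolation {Y D : ℂ} {μ : ℝ} (hμ0 : 0 ≤ μ) (hμ1 : μ ≤ 1)
    (hY : 0 < Y.re) (hD : |D.im| < Real.pi) (hYD : 0 < (Y * exp (-D)).re) :
    0 < (Y * exp (-(μ * D))).re := by
  have hY0 : Y ≠ 0 := by
    rintro rfl
    simp at hY
  set b := (log Y).im with hb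
  have hbpi : |b| < Real.pi / 2 := by
    rw [hb, log_im]
    exact Complex.abs_arg_lt_pi_div_two_iff.2 (Or.inl hY)
  have key : ∀ E : ℂ, (Y * exp (-E)).re = Real.exp ((log Y - E).re) * Real.cos (b - E.im) := by
    intro E
    conv_lhs => rw [← exp_log hY0, ← exp_add, ← sub_eq_add_neg, exp_re]
    simp [hb]
  rw [key] at hYD ⊢
  have hcos : 0 < Real.cos (b - D.im) := pos_of_mul_pos_right hYD (Real.exp_pos _).le
  refine mul_pos (Real.exp_pos _) (Real.cos_pos_of_mem_Ioo ?_)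
  rw [abs_lt] at hbpi hD
  have h1 : b - D.im < Real.pi / 2 := by
    by_contra! h
    exact hcos.not_ge (Real.cos_nonpos_of_pi_div_two_le_of_le h (by linarith))
  have h2 : -(Real.pi / 2) < b - D.im := by
    by_contra! h
    rw [← Real.cos_neg] at hcos
    exact hcos.not_ge (Real.cos_nonpos_of_pi_div_two_le_of_le (by linarith) (by linarith))
  have him : ((μ : ℂ) * D).im = μ * D.im := by simp
  rw [him]
  have hconv := convex_Ioo (-(Real.pi / 2)) (Real.pi / 2) (mem_Ioo.2 hbpi) (mem_Ioo.2 ⟨h2, h1⟩)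
    (sub_nonneg.2 hμ1) hμ0 (by ring)
  convert hconv using 1
  simp only [smul_eq_mul]
  ring

/-- The principal branch of `(1 + z) ^ a`. -/
noncomputable def onePlusPow (a : ℝ) (z : ℂ) : ℂ := exp (a * log (1 + z))

lemma one_add_re_pos {z : ℂ} (hz : z ∈ ball (0 : ℂ) 1) : 0 < (1 + z).re := by
  have h1 : ‖z‖ < 1 := by simpa using hz
  have h2 := neg_le_of_abs_le (abs_re_le_norm z)
  simp only [add_re, one_re]
  linarith

lemma one_add_ne_zero_of_mem_ball {z : ℂ} (hz : z ∈ ball (0 : ℂ) 1) : 1 + z ≠ 0 := by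
  intro h
  simpa [h] using one_add_re_pos hz

lemma abs_log_one_add_im_lt {z : ℂ} (hz : z ∈ ball (0 : ℂ) 1) :
    |(log (1 + z)).im| < Real.pi / 2 := by
  rw [log_im]
  exact Complex.abs_arg_lt_pi_div_two_iff.2 (Or.inl (one_add_re_pos hz))

@[simp] lemma onePlusPow_zero (a : ℝ) : onePlusPow a 0 = 1 := by simp [onePlusPow]

lemma onePlusPow_ne_zero (a : ℝ) (z : ℂ) : onePlusPow a z ≠ 0 := exp_ne_zero _

lemma hasDerivAt_onePlusPow (a : ℝ) {z : ℂ} (hz : z ∈ ball (0 : ℂ) 1) :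
    HasDerivAt (onePlusPow a) (a * onePlusPow (a - 1) z) z := by
  have h1 : HasDerivAt (fun z : ℂ => 1 + z) 1 z := (hasDerivAt_id z).const_add 1
  have h2 := ((h1.clog (Or.inl (one_add_re_pos hz))).const_mul (a : ℂ)).cexp
  refine h2.congr_deriv ?_
  have h3 := one_add_ne_zero_of_mem_ball hz
  have h4 : onePlusPow (a - 1) z = exp (a * log (1 + z)) / (1 + z) := by
    conv_rhs => rw [← exp_log h3, ← exp_sub, exp_log h3]
    rw [onePlusPow]
    push_cast
    ring_nf
  rw [h4]
  ring

lemma onePlusPow_div (μ : ℝ) (z w : ℂ) :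
    onePlusPow (-μ) z / onePlusPow (-μ) w = exp (-(μ * (log (1 + z) - log (1 + w)))) := by
  rw [onePlusPow, onePlusPow, ← exp_sub]
  push_cast
  ring_nf

lemma re_mul_onePlusPow_div_pos {Y z w : ℂ} {μ : ℝ} (hμ0 : 0 ≤ μ) (hμ1 : μ ≤ 1)
    (hz : z ∈ ball (0 : ℂ) 1) (hw : w ∈ ball (0 : ℂ) 1) (hY : 0 < Y.re)
    (hYzw : 0 < (Y * ((1 + w) / (1 + z))).re) :
    0 < (Y * (onePlusPow (-μ) z / onePlusPow (-μ) w)).re := by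
  rw [onePlusPow_div]
  refine re_mul_exp_pos_of_interpolation hμ0 hμ1 hY ?_ ?_
  · have h1 := abs_lt.1 (abs_log_one_add_im_lt hz)
    have h2 := abs_lt.1 (abs_log_one_add_im_lt hw)
    rw [sub_im, abs_lt]
    constructor <;> linarith [h1.1, h1.2, h2.1, h2.2]
  · rw [neg_sub, exp_sub, exp_log (one_add_ne_zero_of_mem_ball hz),
      exp_log (one_add_ne_zero_of_mem_ball hw)]
    exact hYzw

lemma re_inv_pos {z : ℂ} (hz : 0 < z.re) : 0 < (z⁻¹).re := by
  rw [inv_re]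
  refine div_pos hz (normSq_pos.2 ?_)
  rintro rfl
  simp at hz

lemma re_div_one_add_lt {w : ℂ} (hw : w ∈ ball (0 : ℂ) 1) : (w / (1 + w)).re < 1 / 2 := by
  have h0 : 0 < normSq (1 + w) := normSq_pos.2 (one_add_ne_zero_of_mem_ball hw)
  have h1 : normSq w < 1 := by
    rw [normSq_eq_norm_sq]
    have : ‖w‖ < 1 := by simpa using hw
    nlinarith [norm_nonneg w]
  rw [div_re, ← add_div, div_lt_iff₀ h0]
  simp only [normSq_apply, add_re, one_re, add_im, one_im] at h1 ⊢
  nlinarith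

lemma half_le_re_div_one_add {w : ℂ} (hw : 1 ≤ ‖w‖) (hne : 1 + w ≠ 0) :
    1 / 2 ≤ (w / (1 + w)).re := by
  have h0 : 0 < normSq (1 + w) := normSq_pos.2 hne
  have h1 : 1 ≤ normSq w := by
    rw [normSq_eq_norm_sq]
    nlinarith
  rw [div_re, ← add_div, le_div_iff₀ h0]
  simp only [normSq_apply, add_re, one_re, add_im, one_im] at h1 ⊢
  nlinarith

lemma half_lt_re_inv {Y : ℂ} (hY : ‖1 - Y‖ < 1) (hne : Y ≠ 0) : 1 / 2 < (Y⁻¹).re := by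
  have h0 : 0 < normSq Y := normSq_pos.2 hne
  have h1 : normSq (1 - Y) < 1 := by
    rw [normSq_eq_norm_sq]
    nlinarith [norm_nonneg (1 - Y)]
  rw [inv_re, lt_div_iff₀ h0]
  simp only [normSq_apply, sub_re, one_re, sub_im, one_im] at h1 ⊢
  nlinarith

/-- The image of a disk `|v| < |ζ|` under `(1 + z) ^ a` lies strictly on one side of the tangent
line at `ζ` to its boundary. -/
lemma re_onePlusPow_div_lt {a : ℝ} (ha0 : 0 < a) (ha1 : a ≤ 1) {v ζ : ℂ}
    (hζ : ζ ∈ ball (0 : ℂ) 1) (hv : ‖v‖ < ‖ζ‖) :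
    (onePlusPow a v / (ζ * (a * onePlusPow (a - 1) ζ))).re <
      (onePlusPow a ζ / (ζ * (a * onePlusPow (a - 1) ζ))).re := by
  have hζ0 : ζ ≠ 0 := norm_pos_iff.1 ((norm_nonneg v).trans_lt hv)
  have hvb : v ∈ ball (0 : ℂ) 1 := by
    rw [mem_ball_zero_iff] at hζ ⊢
    exact hv.trans hζ
  have ha : (a : ℂ) ≠ 0 := by exact_mod_cast ha0.ne'
  have hq := onePlusPow_ne_zero (a - 1) ζ
  set Y : ℂ := 1 - v / ζ with hYdef
  have hY1 : ‖1 - Y‖ < 1 := by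
    rw [hYdef, sub_sub_cancel, norm_div, div_lt_one ((norm_nonneg v).trans_lt hv)]
    exact hv
  have hYre : 0 < Y.re := by
    have := (abs_re_le_norm (1 - Y)).trans_lt hY1
    rw [abs_lt, sub_re, one_re] at this
    linarith [this.2]
  have hY0 : Y ≠ 0 := by
    intro h
    simp [h] at hYre
  have hpath : ∀ t ∈ Icc (0 : ℝ) 1, v + t * (ζ - v) ∈ ball (0 : ℂ) 1 := by
    intro t ht
    have := (convex_ball (0 : ℂ) 1).add_smul_sub_mem hvb hζ ht
    simpa using this
  have h := re_lt_re_of_hasDerivAt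
    (φ := fun t : ℝ => onePlusPow a (v + t * (ζ - v)) / (ζ * (a * onePlusPow (a - 1) ζ)))
    (φ' := fun t : ℝ => Y * (onePlusPow (-(1 - a)) (v + t * (ζ - v)) / onePlusPow (-(1 - a)) ζ))
    ?_ ?_
  · simpa using h
  · intro t ht
    have h1 : HasDerivAt (fun t : ℂ => v + t * (ζ - v)) (ζ - v) (t : ℂ) := by
      simpa using ((hasDerivAt_id (t : ℂ)).mul_const (ζ - v)).const_add v
    have h2 := ((hasDerivAt_onePlusPow a (hpath t ht)).comp (t : ℂ) h1).div_const
      (ζ * (a * onePlusPow (a - 1) ζ))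
    refine h2.comp_ofReal.congr_deriv ?_
    rw [neg_sub, hYdef]
    field_simp
  · intro t ht
    have hu := hpath t (Ioo_subset_Icc_self ht)
    refine re_mul_onePlusPow_div_pos (by linarith) (by linarith) hu hζ hYre ?_
    have h1ζ := one_add_ne_zero_of_mem_ball hζ
    have h1u := one_add_ne_zero_of_mem_ball hu
    have heq : Y * ((1 + ζ) / (1 + (v + t * (ζ - v)))) =
        (Y⁻¹ - ((1 - t : ℝ) : ℂ) * (ζ / (1 + ζ)))⁻¹ := by
      have hid : (1 + (v + t * (ζ - v))) = 1 + ζ - ((1 - t : ℝ) : ℂ) * Y * ζ := by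
        rw [hYdef]
        push_cast
        field_simp
        ring
      rw [hid] at h1u ⊢
      rw [eq_comm, inv_eq_iff_eq_inv, mul_inv, inv_div]
      field_simp
    rw [heq]
    refine re_inv_pos ?_
    rw [sub_re, re_ofReal_mul]
    nlinarith [half_lt_re_inv hY1 hY0, re_div_one_add_lt hζ, ht.1, ht.2]

/-- The primitive of `(1 + z) ^ a` vanishing at `0`. -/
noncomputable def onePlusPowPrimitive (a : ℝ) (z : ℂ) : ℂ :=
  (onePlusPow (1 + a) z - 1) / ((1 + a : ℝ) : ℂ)

lemma hasDerivAt_onePlusPowPrimitive {a : ℝ} (ha : 0 < a) {z : ℂ} (hz : z ∈ ball (0 : ℂ) 1) :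
    HasDerivAt (onePlusPowPrimitive a) (onePlusPow a z) z := by
  have h := ((hasDerivAt_onePlusPow (1 + a) hz).sub_const 1).div_const ((1 + a : ℝ) : ℂ)
  refine h.congr_deriv ?_
  have : ((1 + a : ℝ) : ℂ) ≠ 0 := by exact_mod_cast (by positivity : 1 + a ≠ 0)
  rw [add_sub_cancel_left, mul_div_cancel_left₀ _ this]

lemma mul_hFun {a : ℝ} (z : ℂ) : z * hFun a z = onePlusPowPrimitive a z := by
  rw [hFun, onePlusPowPrimitive]
  split_ifs with hz
  · simp [hz]
  · rw [onePlusPow]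
    field_simp

lemma hFun_eq_dslope {a : ℝ} (ha : 0 < a) : hFun a = dslope (onePlusPowPrimitive a) 0 := by
  funext z
  rcases eq_or_ne z 0 with rfl | hz
  · rw [dslope_same, (hasDerivAt_onePlusPowPrimitive ha (mem_ball_self one_pos)).deriv]
    simp [hFun]
  · rw [dslope_of_ne _ hz, slope_def_field, ← mul_hFun, ← mul_hFun]
    field_simp
    ring

lemma differentiableOn_hFun {a : ℝ} (ha : 0 < a) :
    DifferentiableOn ℂ (hFun a) (ball 0 1) := by
  rw [hFun_eq_dslope ha, Complex.differentiableOn_dslope (ball_mem_nhds 0 one_pos)]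
  exact fun z hz =>
    (hasDerivAt_onePlusPowPrimitive ha hz).differentiableAt.differentiableWithinAt

lemma hasDerivAt_hFun {a : ℝ} (ha : 0 < a) {z : ℂ} (hz : z ∈ ball (0 : ℂ) 1) :
    HasDerivAt (hFun a) (deriv (hFun a) z) z :=
  ((differentiableOn_hFun ha).differentiableAt (isOpen_ball.mem_nhds hz)).hasDerivAt

lemma hFun_add_mul_deriv {a : ℝ} (ha : 0 < a) {z : ℂ} (hz : z ∈ ball (0 : ℂ) 1) :
    hFun a z + z * deriv (hFun a) z = onePlusPow a z := by
  have h1 := (hasDerivAt_id z).mul (hasDerivAt_hFun ha hz)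
  have h2 : (id * hFun a : ℂ → ℂ) = onePlusPowPrimitive a := funext fun z => mul_hFun z
  rw [h2] at h1
  simpa using h1.unique (hasDerivAt_onePlusPowPrimitive ha hz)

lemma two_mul_deriv_hFun_zero {a : ℝ} (ha : 0 < a) : 2 * deriv (hFun a) 0 = a := by
  have h0 : (0 : ℂ) ∈ ball (0 : ℂ) 1 := mem_ball_self one_pos
  have hd : DifferentiableAt ℂ (deriv (hFun a)) 0 :=
    ((differentiableOn_hFun ha).deriv isOpen_ball).differentiableAt (isOpen_ball.mem_nhds h0)
  have h1 := (hasDerivAt_hFun ha h0).add ((hasDerivAt_id (0 : ℂ)).mul hd.hasDerivAt)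
  have h2 := (hasDerivAt_onePlusPow a h0).congr_of_eventuallyEq
    (f₁ := hFun a + id * deriv (hFun a)) <| by
      filter_upwards [isOpen_ball.mem_nhds h0] with z hz using hFun_add_mul_deriv ha hz
  have h3 := h1.unique h2
  simp at h3
  rw [two_mul, h3]

lemma re_deriv_hFun_div_pos {a : ℝ} (ha : 0 < a) {c w : ℂ} (hw : w ∈ ball (0 : ℂ) 1)
    (hc : ∀ t ∈ Icc (0 : ℝ) 1, 0 < (a * onePlusPow (a - 1) (t * w) / c).re) :
    0 < (deriv (hFun a) w / c).re := by
  rcases eq_or_ne w 0 with rfl | hw0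
  · have h := hc 0 (by simp)
    have h1 : (a : ℂ) * onePlusPow (a - 1) (((0 : ℝ) : ℂ) * 0) / c =
        ((2 : ℝ) : ℂ) * (deriv (hFun a) 0 / c) := by
      rw [mul_zero, onePlusPow_zero, mul_one, ← two_mul_deriv_hFun_zero ha]
      push_cast
      ring
    rw [h1, re_ofReal_mul] at h
    linarith
  · have hball : ∀ t ∈ Icc (0 : ℝ) 1, (t : ℂ) * w ∈ ball (0 : ℂ) 1 := by
      intro t ht
      simpa using (convex_ball (0 : ℂ) 1).smul_mem_of_zero_mem (mem_ball_self one_pos) hw ht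
    have h := re_lt_re_of_hasDerivAt
      (φ := fun t : ℝ => ((t * w) * onePlusPow a (t * w) - onePlusPowPrimitive a (t * w)) /
        (w ^ 2 * c))
      (φ' := fun t : ℝ => t * (a * onePlusPow (a - 1) (t * w) / c)) ?_ ?_
    · have h1 : deriv (hFun a) w / c =
          (w * onePlusPow a w - onePlusPowPrimitive a w) / (w ^ 2 * c) := by
        rw [← hFun_add_mul_deriv ha hw, ← mul_hFun]
        field_simp
        ring
      rw [h1]
      simpa [onePlusPowPrimitive] using h
    · intro t ht
      have h1 : HasDerivAt (fun t : ℂ => t * w) w (t : ℂ) := by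
        simpa using (hasDerivAt_id (t : ℂ)).mul_const w
      have h2 := (hasDerivAt_onePlusPow a (hball t ht)).comp (t : ℂ) h1
      have h3 := (hasDerivAt_onePlusPowPrimitive ha (hball t ht)).comp (t : ℂ) h1
      refine (((h1.mul h2).sub h3).div_const (w ^ 2 * c)).comp_ofReal.congr_deriv ?_
      simp only [Function.comp_apply]
      field_simp
      ring
    · intro t ht
      rw [re_ofReal_mul]
      exact mul_pos ht.1 (hc t (Ioo_subset_Icc_self ht))

lemma re_deriv_hFun_pos {a : ℝ} (ha0 : 0 < a) (ha1 : a ≤ 1) {w : ℂ}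
    (hw : w ∈ ball (0 : ℂ) 1) : 0 < (deriv (hFun a) w).re := by
  have h := re_deriv_hFun_div_pos ha0 (c := 1) hw fun t ht => ?_
  · simpa using h
  · have hball : (t : ℂ) * w ∈ ball (0 : ℂ) 1 := by
      simpa using (convex_ball (0 : ℂ) 1).smul_mem_of_zero_mem (mem_ball_self one_pos) hw ht
    have h1 := re_mul_onePlusPow_div_pos (Y := 1) (μ := 1 - a) (by linarith) (by linarith)
      hball (mem_ball_self one_pos) (by simp) (by simpa using re_inv_pos (one_add_re_pos hball))
    rw [onePlusPow_zero, one_mul, div_one, neg_sub] at h1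
    rw [div_one, re_ofReal_mul]
    exact mul_pos ha0 h1

lemma re_deriv_hFun_div_deriv_pos {a : ℝ} (ha0 : 0 < a) (ha1 : a ≤ 1) {w : ℂ}
    (hw : w ∈ ball (0 : ℂ) 1) :
    0 < (deriv (hFun a) w / (a * onePlusPow (a - 1) w)).re := by
  refine re_deriv_hFun_div_pos ha0 hw fun t ht => ?_
  have hball : (t : ℂ) * w ∈ ball (0 : ℂ) 1 := by
    simpa using (convex_ball (0 : ℂ) 1).smul_mem_of_zero_mem (mem_ball_self one_pos) hw ht
  have ha : (a : ℂ) ≠ 0 := by exact_mod_cast ha0.ne'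
  rw [mul_div_mul_left _ _ ha]
  have h1 := re_mul_onePlusPow_div_pos (Y := 1) (μ := 1 - a) (by linarith) (by linarith)
    hball hw (by simp) ?_
  · rwa [one_mul, neg_sub] at h1
  · rw [one_mul, div_re, ← add_div]
    refine div_pos ?_ (normSq_pos.2 (one_add_ne_zero_of_mem_ball hball))
    have hre := neg_le_of_abs_le (abs_re_le_norm w)
    have hw1 : ‖w‖ < 1 := by simpa using hw
    have hsq : w.re ^ 2 + w.im ^ 2 = ‖w‖ ^ 2 := by
      rw [← normSq_eq_norm_sq, normSq_apply]
      ring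
    have ht0 := ht.1
    have ht1 := ht.2
    have htw : t * ‖w‖ ≤ ‖w‖ := mul_le_of_le_one_left (norm_nonneg w) ht1
    simp only [add_re, one_re, re_ofReal_mul, add_im, one_im, im_ofReal_mul, zero_add]
    have : 0 < (1 - ‖w‖) * (1 - t * ‖w‖) := mul_pos (by linarith) (by linarith)
    nlinarith

lemma injOn_hFun {a : ℝ} (ha0 : 0 < a) (ha1 : a ≤ 1) : InjOn (hFun a) (ball 0 1) := by
  intro u hu v hv huv
  by_contra hne
  have hsub : v - u ≠ 0 := sub_ne_zero.2 (Ne.symm hne)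
  have hpath : ∀ t ∈ Icc (0 : ℝ) 1, u + t * (v - u) ∈ ball (0 : ℂ) 1 := by
    intro t ht
    simpa using (convex_ball (0 : ℂ) 1).add_smul_sub_mem hu hv ht
  have h := re_lt_re_of_hasDerivAt (φ := fun t : ℝ => hFun a (u + t * (v - u)) / (v - u))
    (φ' := fun t : ℝ => deriv (hFun a) (u + t * (v - u))) ?_ ?_
  · simp [huv] at h
  · intro t ht
    have h1 : HasDerivAt (fun t : ℂ => u + t * (v - u)) (v - u) (t : ℂ) := by
      simpa using ((hasDerivAt_id (t : ℂ)).mul_const (v - u)).const_add u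
    refine (((hasDerivAt_hFun ha0 (hpath t ht)).comp (t : ℂ) h1).div_const
      (v - u)).comp_ofReal.congr_deriv ?_
    field_simp
  · intro t ht
    exact re_deriv_hFun_pos ha0 ha1 (hpath t (Ioo_subset_Icc_self ht))

lemma hasStrictDerivAt_hFun {a : ℝ} (ha : 0 < a) {z : ℂ} (hz : z ∈ ball (0 : ℂ) 1) :
    HasStrictDerivAt (hFun a) (deriv (hFun a) z) z :=
  ((differentiableOn_hFun ha).analyticAt (isOpen_ball.mem_nhds hz)).hasStrictDerivAt

lemma deriv_hFun_ne_zero {a : ℝ} (ha0 : 0 < a) (ha1 : a ≤ 1) {z : ℂ}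
    (hz : z ∈ ball (0 : ℂ) 1) : deriv (hFun a) z ≠ 0 := by
  intro h
  simpa [h] using re_deriv_hFun_pos ha0 ha1 hz

lemma isOpen_image_hFun {a : ℝ} (ha0 : 0 < a) (ha1 : a ≤ 1) :
    IsOpen (hFun a '' ball 0 1) := by
  rw [isOpen_iff_mem_nhds]
  rintro _ ⟨u, hu, rfl⟩
  rw [← (hasStrictDerivAt_hFun ha0 hu).map_nhds_eq (deriv_hFun_ne_zero ha0 ha1 hu)]
  exact Filter.image_mem_map (isOpen_ball.mem_nhds hu)

/-- The inverse of `hFun a` on the unit disk. -/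
noncomputable def hFunInv (a : ℝ) : ℂ → ℂ := Function.invFunOn (hFun a) (ball 0 1)

lemma hFunInv_mem {a : ℝ} {y : ℂ} (hy : y ∈ hFun a '' ball 0 1) : hFunInv a y ∈ ball (0 : ℂ) 1 :=
  Function.invFunOn_mem hy

lemma hFun_hFunInv {a : ℝ} {y : ℂ} (hy : y ∈ hFun a '' ball 0 1) : hFun a (hFunInv a y) = y :=
  Function.invFunOn_eq hy

lemma hFunInv_hFun {a : ℝ} (ha0 : 0 < a) (ha1 : a ≤ 1) {u : ℂ} (hu : u ∈ ball (0 : ℂ) 1) :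
    hFunInv a (hFun a u) = u :=
  injOn_hFun ha0 ha1 (hFunInv_mem (mem_image_of_mem _ hu)) hu
    (hFun_hFunInv (mem_image_of_mem _ hu))

lemma hFunInv_one {a : ℝ} (ha0 : 0 < a) (ha1 : a ≤ 1) : hFunInv a 1 = 0 := by
  have h : hFun a 0 = 1 := by simp [hFun]
  rw [← h, hFunInv_hFun ha0 ha1 (mem_ball_self one_pos)]

lemma differentiableOn_hFunInv {a : ℝ} (ha0 : 0 < a) (ha1 : a ≤ 1) :
    DifferentiableOn ℂ (hFunInv a) (hFun a '' ball 0 1) := by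
  rintro _ ⟨u, hu, rfl⟩
  refine ((hasStrictDerivAt_hFun ha0 hu).to_local_left_inverse
    (deriv_hFun_ne_zero ha0 ha1 hu) ?_).hasDerivAt.differentiableAt.differentiableWithinAt
  filter_upwards [isOpen_ball.mem_nhds hu] with v hv using hFunInv_hFun ha0 ha1 hv

/-- `h(ζ) + k ζ h'(ζ)` with `k ≥ 1` lies outside the image of `|v| < |ζ|` under `(1 + z) ^ a`. -/
lemma hFun_add_mul_deriv_ne {a : ℝ} (ha0 : 0 < a) (ha1 : a ≤ 1) {k : ℝ} (hk : 1 ≤ k) {v ζ : ℂ}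
    (hζ : ζ ∈ ball (0 : ℂ) 1) (hv : ‖v‖ < ‖ζ‖) :
    hFun a ζ + k * ζ * deriv (hFun a) ζ ≠ onePlusPow a v := by
  intro h
  have hζ0 : ζ ≠ 0 := norm_pos_iff.1 ((norm_nonneg v).trans_lt hv)
  have ha : (a : ℂ) ≠ 0 := by exact_mod_cast ha0.ne'
  have hq := onePlusPow_ne_zero (a - 1) ζ
  have h1 := re_onePlusPow_div_lt ha0 ha1 hζ hv
  have h2 := re_deriv_hFun_div_deriv_pos ha0 ha1 hζ
  have h3 : onePlusPow a v / (ζ * (a * onePlusPow (a - 1) ζ)) =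
      onePlusPow a ζ / (ζ * (a * onePlusPow (a - 1) ζ)) +
        ((k - 1 : ℝ) : ℂ) * (deriv (hFun a) ζ / (a * onePlusPow (a - 1) ζ)) := by
    rw [← h, ← hFun_add_mul_deriv ha0 hζ]
    push_cast
    field_simp
    ring
  rw [h3, add_re, re_ofReal_mul] at h1
  nlinarith

lemma mapsTo_image_hFun {a : ℝ} (ha0 : 0 < a) (ha1 : a ≤ 1) {F w : ℂ → ℂ}
    (hF : DifferentiableOn ℂ F (ball 0 1)) (hF0 : F 0 = 1)
    (hw : DifferentiableOn ℂ w (ball 0 1)) (hwm : MapsTo w (ball 0 1) (ball 0 1)) (hw0 : w 0 = 0)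
    (hFw : ∀ z ∈ ball (0 : ℂ) 1, F z + z * deriv F z = onePlusPow a (w z)) :
    MapsTo F (ball 0 1) (hFun a '' ball 0 1) := by
  by_contra hcon
  simp only [MapsTo, not_forall] at hcon
  obtain ⟨x, hx, hFx⟩ := hcon
  have hx1 : ‖x‖ < 1 := by simpa using hx
  have hcompact : IsCompact (closedBall (0 : ℂ) ‖x‖ ∩ F ⁻¹' (hFun a '' ball 0 1)ᶜ) :=
    (isCompact_closedBall _ _).of_isClosed_subset
      ((hF.continuousOn.mono (closedBall_subset_ball hx1)).preimage_isClosed_of_isClosed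
        isClosed_closedBall (isOpen_image_hFun ha0 ha1).isClosed_compl) inter_subset_left
  obtain ⟨z₀, ⟨hz₀x, hFz₀⟩, hmin⟩ := hcompact.exists_isMinOn ⟨x, by simp, hFx⟩
    continuous_norm.continuousOn
  have hz₀x : ‖z₀‖ ≤ ‖x‖ := by simpa using hz₀x
  have hz₀1 : ‖z₀‖ < 1 := hz₀x.trans_lt hx1
  have hz₀ne : z₀ ≠ 0 := by
    rintro rfl
    exact hFz₀ ⟨0, mem_ball_self one_pos, by simp [hF0, hFun]⟩
  have hsub : ball (0 : ℂ) ‖z₀‖ ⊆ ball 0 1 := ball_subset_ball hz₀1.le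
  have hmaps : MapsTo F (ball 0 ‖z₀‖) (hFun a '' ball 0 1) := by
    intro z hz
    by_contra hFz
    have hz' : ‖z‖ < ‖z₀‖ := by simpa using hz
    exact hz'.not_ge (hmin ⟨by simpa using hz'.le.trans hz₀x, hFz⟩)
  set ω : ℂ → ℂ := hFunInv a ∘ F with hωdef
  have hω : DifferentiableOn ℂ ω (ball 0 ‖z₀‖) :=
    (differentiableOn_hFunInv ha0 ha1).comp (hF.mono hsub) hmaps
  have hω0 : ω 0 = 0 := by rw [hωdef, Function.comp_apply, hF0, hFunInv_one ha0 ha1]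
  have hhω : ∀ z ∈ ball (0 : ℂ) ‖z₀‖, hFun a (ω z) = F z := fun z hz => hFun_hFunInv (hmaps hz)
  obtain ⟨z₁, hz₁, hωz₁⟩ : ∃ z ∈ ball (0 : ℂ) ‖z₀‖, ‖z₀‖ < ‖ω z‖ := by
    by_contra! hle
    have hK : IsClosed (hFun a '' closedBall 0 ‖z₀‖) :=
      ((isCompact_closedBall _ _).image_of_continuousOn
        ((differentiableOn_hFun ha0).continuousOn.mono (closedBall_subset_ball hz₀1))).isClosed
    have hcl : z₀ ∈ closure (ball (0 : ℂ) ‖z₀‖) := by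
      rw [closure_ball _ (norm_ne_zero_iff.2 hz₀ne)]
      simp
    have hcont : ContinuousWithinAt F (ball 0 ‖z₀‖) z₀ :=
      (hF.continuousOn z₀ (by simpa using hz₀1)).mono hsub
    have hmem : F z₀ ∈ hFun a '' closedBall 0 ‖z₀‖ := by
      have := hcont.mem_closure hcl (t := hFun a '' closedBall 0 ‖z₀‖) fun z hz =>
        ⟨ω z, by simpa using hle z hz, hhω z hz⟩
      rwa [hK.closure_eq] at this
    exact hFz₀ (image_mono (closedBall_subset_ball hz₀1) hmem)
  have hz₁' : ‖z₁‖ < ‖z₀‖ := by simpa using hz₁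
  obtain ⟨z₂, hz₂, hmax⟩ := (isCompact_closedBall (0 : ℂ) ‖z₁‖).exists_isMaxOn
    ⟨z₁, by simp⟩ (hω.continuousOn.mono (closedBall_subset_ball hz₁')).norm
  have hz₂' : ‖z₂‖ ≤ ‖z₁‖ := by simpa using hz₂
  have hz₂b : z₂ ∈ ball (0 : ℂ) ‖z₀‖ := by simpa using hz₂'.trans_lt hz₁'
  have hz₂lt : ‖z₂‖ < ‖ω z₂‖ :=
    (hz₂'.trans_lt hz₁').trans (hωz₁.trans_le (hmax (by simp)))
  obtain ⟨k, hk, hkω⟩ := exists_mul_deriv_eq_of_isMax hω hω0 hz₂b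
    (norm_pos_iff.1 ((norm_nonneg _).trans_lt hz₂lt))
    fun z hz => hmax (by simpa using hz.trans hz₂')
  have hωz₂ : ω z₂ ∈ ball (0 : ℂ) 1 := hFunInv_mem (hmaps hz₂b)
  have hderiv : deriv F z₂ = deriv (hFun a) (ω z₂) * deriv ω z₂ := by
    have h1 := (hasDerivAt_hFun ha0 hωz₂).comp z₂
      (hω.differentiableAt (isOpen_ball.mem_nhds hz₂b)).hasDerivAt
    refine (h1.congr_of_eventuallyEq ?_).deriv
    filter_upwards [isOpen_ball.mem_nhds hz₂b] with z hz using (hhω z hz).symm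
  have hwz₂ : ‖w z₂‖ ≤ ‖z₂‖ :=
    norm_le_norm_of_mapsTo_ball hw (fun z hz => ball_subset_closedBall (hwm hz)) hw0
      (by simpa using hsub hz₂b)
  refine hFun_add_mul_deriv_ne ha0 ha1 hk hωz₂ (hwz₂.trans_lt hz₂lt) ?_
  rw [← hFw z₂ (hsub hz₂b), hderiv, hhω z₂ hz₂b]
  linear_combination -deriv (hFun a) (ω z₂) * hkω

lemma subord_hFun {a : ℝ} (ha0 : 0 < a) (ha1 : a ≤ 1) {F w : ℂ → ℂ}
    (hF : DifferentiableOn ℂ F (ball 0 1)) (hF0 : F 0 = 1)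
    (hw : DifferentiableOn ℂ w (ball 0 1)) (hwm : MapsTo w (ball 0 1) (ball 0 1)) (hw0 : w 0 = 0)
    (hFw : ∀ z ∈ ball (0 : ℂ) 1, F z + z * deriv F z = onePlusPow a (w z)) :
    Subord F (hFun a) := by
  have hmaps := mapsTo_image_hFun ha0 ha1 hF hF0 hw hwm hw0 hFw
  refine ⟨hFunInv a ∘ F, (differentiableOn_hFunInv ha0 ha1).comp hF hmaps,
    fun z hz => hFunInv_mem (hmaps hz), ?_, fun z hz => (hFun_hFunInv (hmaps hz)).symm⟩
  rw [Function.comp_apply, hF0, hFunInv_one ha0 ha1]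

/-- If `Re (z p'(z) / p(z)) < a / 2` and `p 0 = 1`, then `p` is subordinate to `(1 + z) ^ a`. -/
lemma subord_onePlusPow {a : ℝ} (ha : 0 < a) {p : ℂ → ℂ}
    (hp : DifferentiableOn ℂ p (ball 0 1)) (hp0 : p 0 = 1) (hpne : ∀ z ∈ ball (0 : ℂ) 1, p z ≠ 0)
    (hre : ∀ z ∈ ball (0 : ℂ) 1, (z * deriv p z / p z).re < a / 2) :
    Subord p (onePlusPow a) := by
  have h0 : (0 : ℂ) ∈ ball (0 : ℂ) 1 := mem_ball_self one_pos
  have hpre : IsPreconnected (ball (0 : ℂ) 1) := (convex_ball (0 : ℂ) 1).isPreconnected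
  have hac : (a : ℂ) ≠ 0 := by exact_mod_cast ha.ne'
  have hpd : ∀ z ∈ ball (0 : ℂ) 1, HasDerivAt p (deriv p z) z := fun z hz =>
    (hp.differentiableAt (isOpen_ball.mem_nhds hz)).hasDerivAt
  obtain ⟨L, hL0, hL⟩ := (((hp.deriv isOpen_ball).div hp hpne).isExactOn_ball).with_val_at 0 0
  have hpL : ∀ z ∈ ball (0 : ℂ) 1, p z = exp (L z) := by
    intro z hz
    have hd : ∀ u ∈ ball (0 : ℂ) 1, HasDerivAt (fun u => p u * exp (-L u)) 0 u := by
      intro u hu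
      refine ((hpd u hu).mul (hL u hu).neg.cexp).congr_deriv ?_
      have := hpne u hu
      simp only [Pi.div_apply]
      field_simp
      ring
    have := isOpen_ball.is_const_of_deriv_eq_zero hpre
      (fun u hu => (hd u hu).differentiableAt.differentiableWithinAt)
      (fun u hu => (hd u hu).deriv) hz h0
    simp only [hp0, hL0, neg_zero, exp_zero, mul_one, exp_neg] at this
    rwa [mul_inv_eq_one₀ (exp_ne_zero _)] at this
  set w : ℂ → ℂ := fun z => exp (L z / a) - 1 with hwdef
  have hw0 : w 0 = 0 := by simp [hwdef, hL0]
  have hwd : ∀ z ∈ ball (0 : ℂ) 1, HasDerivAt w ((1 + w z) * (deriv p z / p z / a)) z := by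
    intro z hz
    refine (((hL z hz).div_const (a : ℂ)).cexp.sub_const 1).congr_deriv ?_
    simp [hwdef]
  have hwD : DifferentiableOn ℂ w (ball 0 1) := fun z hz =>
    (hwd z hz).differentiableAt.differentiableWithinAt
  have hwm : MapsTo w (ball 0 1) (ball 0 1) := by
    intro x hx
    by_contra hwx
    have hwx : 1 ≤ ‖w x‖ := by simpa using hwx
    have hx1 : ‖x‖ < 1 := by simpa using hx
    obtain ⟨z, hz, hmax⟩ := (isCompact_closedBall (0 : ℂ) ‖x‖).exists_isMaxOn
      ⟨x, by simp⟩ (hwD.continuousOn.mono (closedBall_subset_ball hx1)).norm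
    have hzx : ‖z‖ ≤ ‖x‖ := by simpa using hz
    have hzb : z ∈ ball (0 : ℂ) 1 := by simpa using hzx.trans_lt hx1
    have hwz : 1 ≤ ‖w z‖ := hwx.trans (hmax (by simp))
    obtain ⟨k, hk, hkw⟩ := exists_mul_deriv_eq_of_isMax hwD hw0 hzb
      (norm_pos_iff.1 (one_pos.trans_le hwz)) fun u hu => hmax (by simpa using hu.trans hzx)
    have hne : 1 + w z ≠ 0 := by simp [hwdef]
    have hpz := hpne z hzb
    rw [(hwd z hzb).deriv] at hkw
    have heq : z * deriv p z / p z = ((a * k : ℝ) : ℂ) * (w z / (1 + w z)) := by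
      push_cast
      rw [mul_assoc, mul_div_assoc', ← hkw]
      field_simp
    have h1 := hre z hzb
    rw [heq, re_ofReal_mul] at h1
    have h2 := half_le_re_div_one_add hwz hne
    have h3 : a * 1 * (1 / 2) ≤ a * k * (w z / (1 + w z)).re := by gcongr
    linarith
  refine ⟨w, hwD, hwm, hw0, fun z hz => ?_⟩
  have hlogd : ∀ u ∈ ball (0 : ℂ) 1,
      HasDerivAt (fun u => a * log (1 + w u) - L u) 0 u := by
    intro u hu
    have h1 := ((hwd u hu).const_add 1).clog (Or.inl (one_add_re_pos (hwm hu)))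
    refine ((h1.const_mul (a : ℂ)).sub (hL u hu)).congr_deriv ?_
    have := one_add_ne_zero_of_mem_ball (hwm hu)
    simp only [Pi.div_apply]
    field_simp
    ring
  have h1 := isOpen_ball.is_const_of_deriv_eq_zero hpre
    (fun u hu => (hlogd u hu).differentiableAt.differentiableWithinAt)
    (fun u hu => (hlogd u hu).deriv) hz h0
  simp only [hw0, hL0, add_zero, log_one, mul_zero, sub_zero] at h1
  rw [hpL z hz, onePlusPow, sub_eq_zero.1 h1]

/-- Let `0 < λ ≤ 1` and `f ∈ 𝒢(λ)`. Then the analytic extension of `f(z)/z`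
(with value `1` at `0`) is subordinate on `𝔻` to `h(z) = ((1+z)^{1+λ} − 1)/((1+λ)z)`
(with value `1` at `0`). -/
theorem stmt6 (lam : ℝ) (hlam0 : 0 < lam) (hlam1 : lam ≤ 1)
    (f : ℂ → ℂ)
    (hf : DifferentiableOn ℂ f (ball 0 1))
    (hf0 : f 0 = 0) (hfd0 : deriv f 0 = 1)
    (hfd : ∀ z ∈ ball (0:ℂ) 1, deriv f z ≠ 0)
    (hG : ∀ z ∈ ball (0:ℂ) 1,
      (1 + z * deriv (deriv f) z / deriv f z).re < 1 + lam / 2)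
    (g : ℂ → ℂ)
    (hg0 : g 0 = 1)
    (hgval : ∀ z ∈ ball (0:ℂ) 1, z ≠ 0 → g z = f z / z) :
    Subord g (hFun lam) := by
  obtain ⟨w, hw, hwm, hw0, hfw⟩ := subord_onePlusPow hlam0 (hf.deriv isOpen_ball) hfd0 hfd
    fun z hz => by simpa using hG z hz
  have hgF : ∀ z ∈ ball (0 : ℂ) 1, g z = dslope f 0 z := by
    intro z hz
    rcases eq_or_ne z 0 with rfl | hz0
    · rw [hg0, dslope_same, hfd0]
    · rw [hgval z hz hz0, dslope_of_ne _ hz0, slope_def_field, hf0, sub_zero, sub_zero]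
  have hF : DifferentiableOn ℂ (dslope f 0) (ball 0 1) :=
    (Complex.differentiableOn_dslope (ball_mem_nhds 0 one_pos)).2 hf
  have hFw : ∀ z ∈ ball (0 : ℂ) 1,
      dslope f 0 z + z * deriv (dslope f 0) z = onePlusPow lam (w z) := by
    intro z hz
    have h1 := (hasDerivAt_id z).mul
      (hF.differentiableAt (isOpen_ball.mem_nhds hz)).hasDerivAt
    have h2 : (id * dslope f 0 : ℂ → ℂ) = f := by
      funext u
      simpa [hf0] using sub_smul_dslope f 0 u
    rw [h2] at h1
    rw [← hfw z hz, h1.deriv]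
    simp
  obtain ⟨ω, hω, hωm, hω0, hFω⟩ :=
    subord_hFun hlam0 hlam1 hF (by rw [dslope_same, hfd0]) hw hwm hw0 hFw
  exact ⟨ω, hω, hωm, hω0, fun z hz => (hgF z hz).trans (hFω z hz)⟩
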